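/- Let n ≥ 1 and d = 2ⁿ. Let H be a d×d complex Hermitian matrix with Tr(H) = 0 and Tr(H²) = d, and for x ∈ ℝ let S(x) be the diagonal d×d matrix whose k-th diagonal entry is exp(i·x·(2·w(k) − n)), where w(k) is the number of ones in the binary expansion of k (this is the Pauli-Z encoding (e^{−ixZ})^{⊗n}). Then for all real x, x′: d · ∫∫ ⟨e₁, U† S(x)† W† H W S(x) U e₁⟩ · ⟨e₁, U† S(x′)† W† H W S(x′) U e₁⟩ dμ(U) dμ(W) = d·(s − 1)/(d³ + d² − d − 1), where s = C(2n, n) + 2 Σ_{m=1}^{n} C(2n, n−m) cos(2m(x − x′)). -/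

import Mathlib

open MeasureTheory Matrix Finset

variable {ι : Type*} [Fintype ι] [DecidableEq ι]

theorem diagonal_mem_unitaryGroup_update (m : ι) :
    diagonal (Function.update (1 : ι → ℂ) m Complex.I) ∈ unitaryGroup ι ℂ := by
  rw [mem_unitaryGroup_iff, star_eq_conjTranspose, diagonal_conjTranspose, diagonal_mul_diagonal,
    ← diagonal_one]
  congr 1
  ext i
  by_cases h : i = m <;> simp [h]

theorem permMatrix_mem_unitaryGroup (σ : Equiv.Perm ι) :
    σ.permMatrix ℂ ∈ unitaryGroup ι ℂ := by
  rw [mem_unitaryGroup_iff, star_eq_conjTranspose, conjTranspose_permMatrix, ← permMatrix_mul]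
  simp

theorem permMatrix_mul_single_mul_star (σ : Equiv.Perm ι) (i j : ι) :
    σ.permMatrix ℂ * single i j 1 * star (σ.permMatrix ℂ) = single (σ.symm i) (σ.symm j) 1 := by
  rw [star_eq_conjTranspose, conjTranspose_permMatrix, PEquiv.toMatrix_toPEquiv_mul,
    PEquiv.mul_toMatrix_toPEquiv, submatrix_submatrix]
  exact submatrix_single_equiv σ σ i j 1

theorem diagonal_mul_single_mul_star (z : ι → ℂ) (i j : ι) :
    diagonal z * single i j 1 * star (diagonal z) = (z i * star (z j)) • single i j (1 : ℂ) := by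
  ext k l
  rw [star_eq_conjTranspose, diagonal_conjTranspose]
  simp [single_apply]
  grind

theorem half_add_I_smul_conj (P X : Matrix ι ι ℂ) (hP : star P = P) :
    ((1 + Complex.I) / 2) • (1 + Complex.I • P) * X *
        star (((1 + Complex.I) / 2) • (1 + Complex.I • P)) =
      (1 / 2 : ℂ) • (X + Complex.I • (P * X) - Complex.I • (X * P) + P * X * P) := by
  have h : (1 + Complex.I) / 2 * star ((1 + Complex.I) / 2) = 1 / 2 := by
    simp only [star_div₀, star_add, star_one, Complex.star_def, Complex.conj_I, map_ofNat]
    linear_combination (-1 / 4 : ℂ) * Complex.I_sq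
  have hI : star Complex.I = -Complex.I := Complex.conj_I
  rw [star_smul, smul_mul_assoc, smul_mul_smul_comm, h, star_add, star_one, star_smul, hP, hI]
  have hII : -Complex.I • Complex.I • (P * X * P) = P * X * P := by rw [smul_smul]; simp
  simp only [mul_add, add_mul, mul_one, one_mul, smul_mul_assoc, mul_smul_comm, smul_add, hII]
  module

theorem half_add_I_smul_mem_unitaryGroup (P : Matrix ι ι ℂ) (hP : star P = P) (h : P * P = 1) :
    ((1 + Complex.I) / 2) • (1 + Complex.I • P) ∈ unitaryGroup ι ℂ := by
  have := half_add_I_smul_conj P 1 hP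
  rw [mem_unitaryGroup_iff]
  rw [mul_one] at this
  rw [this, mul_one, one_mul, h]
  module

/-- A bilinear form on matrices that is invariant under simultaneous unitary conjugation is a
combination of `tr X * tr Y` and `tr (X * Y)`. -/
theorem exists_eq_trace_mul_trace_add_trace_mul [Nontrivial ι]
    (B : Matrix ι ι ℂ →ₗ[ℂ] Matrix ι ι ℂ →ₗ[ℂ] ℂ)
    (hB : ∀ V ∈ unitaryGroup ι ℂ, ∀ X Y, B (V * X * star V) (V * Y * star V) = B X Y) :
    ∃ b c : ℂ, ∀ X Y, B X Y = b * (X.trace * Y.trace) + c * (X * Y).trace := by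
  have hphase (m i j k l : ι) : B (single i j 1) (single k l 1) =
      (Function.update (1 : ι → ℂ) m Complex.I i * star (Function.update (1 : ι → ℂ) m Complex.I j))
      * (Function.update (1 : ι → ℂ) m Complex.I k
        * star (Function.update (1 : ι → ℂ) m Complex.I l))
      * B (single i j 1) (single k l 1) := by
    conv_lhs => rw [← hB _ (diagonal_mem_unitaryGroup_update m)]
    simp only [diagonal_mul_single_mul_star, map_smul, LinearMap.smul_apply, smul_eq_mul]
    ring
  have hI1 : Complex.I ≠ 1 := fun h => by simpa using congrArg Complex.im h
  have hI2 : -Complex.I ≠ 1 := fun h => by simpa using congrArg Complex.im h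
  have hzero (i j k l : ι) (h1 : ¬ (i = j ∧ k = l)) (h2 : ¬ (i = l ∧ k = j)) :
      B (single i j 1) (single k l 1) = 0 := by
    by_cases hij : i = j
    · subst hij
      have hkl : k ≠ l := fun h => h1 ⟨rfl, h⟩
      have := hphase k i i k l
      by_cases hik : i = k <;> simp [hkl.symm, hik] at this <;> grind
    · by_cases hil : i = l
      · subst hil
        have hkj : k ≠ j := fun h => h2 ⟨rfl, h⟩
        have := hphase k i j k i
        by_cases hik : i = k <;> simp [hkj.symm, hik] at this <;> grind
      · have := hphase i i j k l
        by_cases hik : k = i <;>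
          simp [Ne.symm hij, Ne.symm hil, hik] at this <;> grind
  have hperm (σ : Equiv.Perm ι) (i j k l : ι) :
      B (single (σ i) (σ j) 1) (single (σ k) (σ l) 1) = B (single i j 1) (single k l 1) := by
    conv_rhs => rw [← hB _ (permMatrix_mem_unitaryGroup σ.symm)]
    simp only [permMatrix_mul_single_mul_star, Equiv.symm_symm]
  obtain ⟨p, q, hpq⟩ := exists_pair_ne ι
  have htrans {i k : ι} (h : i ≠ k) : ∃ σ : Equiv.Perm ι, σ p = i ∧ σ q = k :=
    MulAction.is_two_pretransitive_iff.1 (Equiv.Perm.isMultiplyPretransitive ι 2) hpq h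
  set b := B (single p p 1) (single q q 1) with hb
  set c := B (single p q 1) (single q p 1) with hc
  have hB1 {i k : ι} (h : i ≠ k) : B (single i i 1) (single k k 1) = b := by
    obtain ⟨σ, rfl, rfl⟩ := htrans h
    exact hperm ..
  have hB2 {i k : ι} (h : i ≠ k) : B (single i k 1) (single k i 1) = c := by
    obtain ⟨σ, rfl, rfl⟩ := htrans h
    exact hperm ..
  have hdiag (i k : ι) : B (single i i 1) (single i i 1) = B (single k k 1) (single k k 1) := by
    simpa using hperm (Equiv.swap k i) k k k k
  have hB3 (i : ι) : B (single i i 1) (single i i 1) = b + c := by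
    obtain ⟨k, hk⟩ := exists_ne i
    have hswap : star ((Equiv.swap i k).permMatrix ℂ) = (Equiv.swap i k).permMatrix ℂ := by
      rw [star_eq_conjTranspose, conjTranspose_permMatrix, Equiv.swap_inv]
    have := hB _ (half_add_I_smul_mem_unitaryGroup _ hswap (by rw [← permMatrix_mul]; simp))
      (single i i 1) (single i i 1)
    have e1 : (Equiv.swap i k).permMatrix ℂ * single i i 1 = single k i 1 := by
      rw [PEquiv.toMatrix_toPEquiv_mul]
      simpa using submatrix_single_equiv (Equiv.swap i k) (Equiv.refl ι) i i (1 : ℂ)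
    have e2 (j : ι) : single j i 1 * (Equiv.swap i k).permMatrix ℂ = single j k 1 := by
      rw [PEquiv.mul_toMatrix_toPEquiv]
      simpa using submatrix_single_equiv (Equiv.refl ι) (Equiv.swap i k).symm j i (1 : ℂ)
    rw [half_add_I_smul_conj _ _ hswap, e1, e2, e2] at this
    simp only [map_smul, map_add, map_sub, LinearMap.smul_apply, LinearMap.add_apply,
      LinearMap.sub_apply, smul_eq_mul, hB1 hk, hB1 hk.symm, hB2 hk, hB2 hk.symm, hdiag k i] at this
    simp (disch := grind) only [hzero] at this
    linear_combination (-2) * this - c * Complex.I_sq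
  refine ⟨b, c, fun X Y => ?_⟩
  induction X using Matrix.induction_on' with
  | h_zero => simp
  | h_add X X' h h' => simp only [map_add, LinearMap.add_apply, trace_add, add_mul, h, h']; ring
  | h_std_basis i j x =>
  induction Y using Matrix.induction_on' with
  | h_zero => simp
  | h_add Y Y' h h' => simp only [map_add, trace_add, mul_add, h, h']; ring
  | h_std_basis k l y =>
  rw [show single i j x = x • single i j 1 by simp, show single k l y = y • single k l 1 by simp]
  have key : B (single i j 1) (single k l 1) =
      b * ((single i j (1 : ℂ)).trace * (single k l (1 : ℂ)).trace)
        + c * (single i j 1 * single k l (1 : ℂ)).trace := by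
    by_cases h1 : i = j ∧ k = l
    · obtain ⟨rfl, rfl⟩ := h1
      by_cases hik : i = k
      · subst hik; simp [hB3]
      · simp [hB1 hik, hik]
    · by_cases h2 : i = l ∧ k = j
      · obtain ⟨rfl, rfl⟩ := h2
        have : i ≠ k := fun h => h1 ⟨h, h.symm⟩
        simp [hB2 this, trace_single_eq_of_ne _ _ _ this]
      · rw [hzero i j k l h1 h2]
        rw [trace_single_mul, single_apply]
        by_cases hij : i = j <;> by_cases hkl : k = l <;> simp_all [trace_single_eq_of_ne] <;> grind
  simp only [map_smul, LinearMap.smul_apply, smul_eq_mul, trace_smul, key, smul_mul_smul_comm]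
  ring

instance compactSpace_unitaryGroup : CompactSpace (unitaryGroup ι ℂ) := by
  refine isCompact_iff_compactSpace.1 (IsCompact.of_isClosed_subset
    (isCompact_univ_pi fun _ : ι => isCompact_univ_pi fun _ : ι => isCompact_closedBall (0 : ℂ) 1)
    isClosed_unitary fun U hU i _ j _ => ?_)
  simpa using entry_norm_bound_of_unitary hU i j

section Haar

variable {G : Type*} [Group G] [TopologicalSpace G] [IsTopologicalGroup G] [CompactSpace G]
  [MeasurableSpace G] [BorelSpace G] (μ : Measure G) [μ.IsHaarMeasure] [IsProbabilityMeasure μ]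

theorem isMulRightInvariant_of_compactSpace : μ.IsMulRightInvariant where
  map_mul_right_eq_self g := by
    have := Measure.isProbabilityMeasure_map (μ := μ) (measurable_mul_const g).aemeasurable
    exact Measure.isHaarMeasure_eq_of_isProbabilityMeasure _ _

theorem isInvInvariant_of_compactSpace : μ.IsInvInvariant where
  inv_eq_self := by
    have := isMulRightInvariant_of_compactSpace μ
    have : IsProbabilityMeasure μ.inv :=
      Measure.isProbabilityMeasure_map measurable_inv.aemeasurable
    have : μ.inv.IsHaarMeasure := by
      refine Measure.isHaarMeasure_of_isCompact_nonempty_interior _ Set.univ isCompact_univ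
        (by simp) (by simp) (by simp)
    exact Measure.isHaarMeasure_eq_of_isProbabilityMeasure _ _

end Haar

theorem continuous_trace_mul_conj (A X : Matrix ι ι ℂ) :
    Continuous fun W : unitaryGroup ι ℂ => (X * (star (W : Matrix ι ι ℂ) * A * W)).trace := by
  fun_prop

/-- Second moment of the conjugation orbit of a matrix under the Haar measure of the unitary
group. -/
theorem integral_trace_mul_conj_mul_trace_mul_conj [Nontrivial ι]
    [MeasurableSpace (unitaryGroup ι ℂ)] [BorelSpace (unitaryGroup ι ℂ)]
    (μ : Measure (unitaryGroup ι ℂ)) [μ.IsHaarMeasure] [IsProbabilityMeasure μ]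
    (A X Y : Matrix ι ι ℂ) :
    (Fintype.card ι : ℂ) * ((Fintype.card ι : ℂ) ^ 2 - 1) *
        ∫ W : unitaryGroup ι ℂ, (X * (star (W : Matrix ι ι ℂ) * A * W)).trace *
          (Y * (star (W : Matrix ι ι ℂ) * A * W)).trace ∂μ =
      (Fintype.card ι * A.trace ^ 2 - (A * A).trace) * (X.trace * Y.trace) +
        (Fintype.card ι * (A * A).trace - A.trace ^ 2) * (X * Y).trace := by
  have hint (X Y : Matrix ι ι ℂ) : Integrable (fun W : unitaryGroup ι ℂ =>
      (X * (star (W : Matrix ι ι ℂ) * A * W)).trace *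
        (Y * (star (W : Matrix ι ι ℂ) * A * W)).trace) μ :=
    ((continuous_trace_mul_conj A X).mul
      (continuous_trace_mul_conj A Y)).integrable_of_hasCompactSupport (.of_compactSpace _)
  let B : Matrix ι ι ℂ →ₗ[ℂ] Matrix ι ι ℂ →ₗ[ℂ] ℂ := LinearMap.mk₂ ℂ
    (fun X Y => ∫ W : unitaryGroup ι ℂ, (X * (star (W : Matrix ι ι ℂ) * A * W)).trace *
      (Y * (star (W : Matrix ι ι ℂ) * A * W)).trace ∂μ)
    (fun X X' Y => by simp only [add_mul, trace_add]; exact integral_add (hint X Y) (hint X' Y))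
    (fun c X Y => by
      simp only [smul_mul_assoc, trace_smul]; exact integral_smul ..)
    (fun X Y Y' => by
      simp only [add_mul, mul_add, trace_add]; exact integral_add (hint X Y) (hint X Y'))
    (fun c X Y => by
      simp only [smul_mul_assoc, mul_smul_comm, trace_smul]; exact integral_smul ..)
  have := isMulRightInvariant_of_compactSpace μ
  obtain ⟨b, c, hbc⟩ := exists_eq_trace_mul_trace_add_trace_mul B fun V hV X Y => by
    simp only [B, LinearMap.mk₂_apply]
    rw [← integral_mul_right_eq_self _ (⟨V, hV⟩⁻¹ : unitaryGroup ι ℂ)]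
    have hVV : star V * V = 1 := mem_unitaryGroup_iff'.1 hV
    have key (W : unitaryGroup ι ℂ) (Z : Matrix ι ι ℂ) :
        (V * Z * star V * (star ((W * (⟨V, hV⟩⁻¹ : unitaryGroup ι ℂ) : unitaryGroup ι ℂ) :
          Matrix ι ι ℂ) * A * ((W * (⟨V, hV⟩⁻¹ : unitaryGroup ι ℂ) : unitaryGroup ι ℂ) :
          Matrix ι ι ℂ))).trace = (Z * (star (W : Matrix ι ι ℂ) * A * W)).trace := by
      rw [UnitaryGroup.mul_val, UnitaryGroup.inv_val, star_mul, star_star]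
      calc _ = (V * (Z * (star V * V) * (star (W : Matrix ι ι ℂ) * A * W) * star V)).trace := by
            simp only [mul_assoc]
        _ = _ := by
            rw [hVV, trace_mul_comm, mul_assoc _ (star V), hVV, mul_one, mul_one]
    simp only [key]
  have hWW (W : unitaryGroup ι ℂ) : (W : Matrix ι ι ℂ) * star (W : Matrix ι ι ℂ) = 1 :=
    mem_unitaryGroup_iff.1 W.2
  have htrace (W : unitaryGroup ι ℂ) (Z : Matrix ι ι ℂ) :
      (star (W : Matrix ι ι ℂ) * Z * W).trace = Z.trace := by
    rw [trace_mul_comm, ← mul_assoc, hWW, one_mul]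
  have h1 : A.trace ^ 2 = b * (Fintype.card ι : ℂ) ^ 2 + c * Fintype.card ι := by
    have := hbc 1 1
    simp only [B, LinearMap.mk₂_apply, one_mul, htrace, trace_one, integral_const, probReal_univ,
      one_smul] at this
    linear_combination this
  have h2 : (A * A).trace = b * Fintype.card ι + c * (Fintype.card ι : ℂ) ^ 2 := by
    calc (A * A).trace = ∫ W : unitaryGroup ι ℂ, (A * A).trace ∂μ := by simp
      _ = ∑ i, ∑ j, B (single i j 1) (single j i 1) := by
        simp only [B, LinearMap.mk₂_apply]
        simp_rw [← integral_finsetSum _ fun j _ => hint (single _ j 1) (single j _ 1)]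
        rw [← integral_finsetSum _ fun i _ =>
          integrable_finsetSum _ fun j _ => hint (single i j 1) (single j i 1)]
        refine integral_congr_ae (.of_forall fun W => ?_)
        simp only [trace_single_mul, one_smul]
        rw [← htrace W, show star (W : Matrix ι ι ℂ) * (A * A) * W =
          (star (W : Matrix ι ι ℂ) * A * W) * (star (W : Matrix ι ι ℂ) * A * W) by
            simp only [mul_assoc]
            rw [← mul_assoc (W : Matrix ι ι ℂ) (star _), hWW, one_mul]]
        rw [trace_mul_comm]
        simp only [trace, diag_apply, mul_apply, mul_comm]
      _ = _ := by
        have htr (i j : ι) : (single i j (1 : ℂ)).trace = if i = j then 1 else 0 := by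
          split_ifs with h
          · rw [h, trace_single_eq_same]
          · rw [trace_single_eq_of_ne _ _ _ h]
        simp only [hbc, trace_single_mul, htr]
        simp [Finset.sum_add_distrib, eq_comm]
        ring
  change _ * B X Y = _
  rw [hbc, h1, h2]
  ring

theorem sum_range_two_mul {M : Type*} [AddCommMonoid M] (f : ℕ → M) (N : ℕ) :
    ∑ k ∈ range (2 * N), f k = ∑ k ∈ range N, (f (2 * k) + f (2 * k + 1)) := by
  induction N with
  | zero => simp
  | succ N ih => rw [mul_add_one, sum_range_succ, sum_range_succ, sum_range_succ, ih, add_assoc]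

theorem sum_range_two_pow_pow_sum_digits {R : Type*} [CommSemiring R] (z : R) (n : ℕ) :
    ∑ k ∈ range (2 ^ n), z ^ (Nat.digits 2 k).sum = (1 + z) ^ n := by
  induction n with
  | zero => simp
  | succ n ih =>
    rw [pow_succ' 2, sum_range_two_mul, pow_succ, ← ih, sum_mul]
    refine sum_congr rfl fun k _ => ?_
    have h1 : (Nat.digits 2 (2 * k + 1)).sum = (Nat.digits 2 k).sum + 1 := by
      rw [Nat.digits_def' one_lt_two (by lia), List.sum_cons,
        show (2 * k + 1) / 2 = k by lia, show (2 * k + 1) % 2 = 1 by lia, add_comm]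
    have h0 : (Nat.digits 2 (2 * k)).sum = (Nat.digits 2 k).sum := by
      rcases k.eq_zero_or_pos with rfl | hk
      · simp
      · rw [Nat.digits_base_mul one_lt_two hk, List.sum_cons, zero_add]
    rw [h0, h1]
    ring

theorem sum_exp_digits (n : ℕ) (δ : ℝ) :
    ∑ k : Fin (2 ^ n), Complex.exp (Complex.I * δ * (2 * ((Nat.digits 2 (k : ℕ)).sum : ℂ) - n)) =
      (2 * Complex.cos δ) ^ n := by
  rw [Fin.sum_univ_eq_sum_range
    (fun k => Complex.exp (Complex.I * δ * (2 * ((Nat.digits 2 k).sum : ℂ) - n)))]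
  calc _ = Complex.exp (-(δ * Complex.I)) ^ n *
        ∑ k ∈ range (2 ^ n), Complex.exp (2 * (δ * Complex.I)) ^ (Nat.digits 2 k).sum := by
        rw [mul_sum]
        refine sum_congr rfl fun k _ => ?_
        rw [← Complex.exp_nat_mul, ← Complex.exp_nat_mul, ← Complex.exp_add]
        congr 1
        ring
    _ = _ := by
        rw [sum_range_two_pow_pow_sum_digits, ← mul_pow, mul_add, ← Complex.exp_add,
          Complex.two_cos, add_comm]
        ring_nf

theorem two_mul_cos_pow_two_mul (n : ℕ) (δ : ℝ) :
    (2 * Real.cos δ) ^ (2 * n) = (2 * n).choose n +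
      2 * ∑ m ∈ Icc 1 n, ((2 * n).choose (n - m) : ℝ) * Real.cos (2 * m * δ) := by
  have hterm (k : ℕ) (m : ℤ) (hk : (k : ℤ) = n + m) (hk' : k ≤ 2 * n) :
      Complex.exp (δ * Complex.I) ^ k * Complex.exp (-(δ * Complex.I)) ^ (2 * n - k) =
        Complex.exp (2 * m * δ * Complex.I) := by
    have hk2 : (k : ℂ) = n + m := by exact_mod_cast hk
    rw [← Complex.exp_nat_mul, ← Complex.exp_nat_mul, ← Complex.exp_add, Nat.cast_sub hk', hk2]
    push_cast
    ring_nf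
  rw [← Complex.ofReal_inj]
  push_cast
  have hIcc : Icc 1 n = Ico 1 (n + 1) := by ext; simp
  rw [Complex.two_cos, neg_mul, add_pow, show 2 * n + 1 = n + (n + 1) by ring, sum_range_add,
    sum_range_succ', ← sum_range_reflect, hIcc, sum_Ico_eq_sum_range, Nat.add_sub_cancel, mul_sum,
    ← add_assoc, ← sum_add_distrib, hterm (n + 0) 0 (by simp) (by lia), add_comm]
  congr 1
  · simp
  refine sum_congr rfl fun j hj => ?_
  have hj := mem_range.1 hj
  rw [hterm (n - 1 - j) (-(1 + j : ℕ)) (by lia) (by lia),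
    hterm (n + (j + 1)) (1 + j : ℕ) (by lia) (by lia), mul_left_comm, Complex.two_cos,
    show (2 * n).choose (n + (j + 1)) = (2 * n).choose (n - (1 + j)) from
      Nat.choose_symm_of_eq_add (by lia), show n - 1 - j = n - (1 + j) by lia]
  push_cast
  ring_nf

theorem trace_mul_conj_single (e : ι) (X U : Matrix ι ι ℂ) :
    (X * (U * single e e 1 * star U)).trace = (star U * X * U) e e := by
  rw [← mul_assoc, trace_mul_comm, ← mul_assoc, ← mul_assoc, trace_mul_single]
  simp

/-- The squared overlap of two pure states obtained from the same vector `U e`. -/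
theorem trace_conj_single_mul_conj_single (e : ι) (A B U : Matrix ι ι ℂ) :
    ((A * U * single e e 1 * star (A * U)) * (B * U * single e e 1 * star (B * U))).trace =
      (star A * B * (U * single e e 1 * star U)).trace *
        (star B * A * (U * single e e 1 * star U)).trace := by
  have hM (X Y : Matrix ι ι ℂ) : (single e e 1 * X * single e e 1 * Y).trace = X e e * Y e e := by
    rw [single_mul_mul_single, trace_single_mul]
    simp
  rw [trace_mul_conj_single e (star A * B), trace_mul_conj_single e (star B * A), ← hM]
  simp only [star_mul, mul_assoc]
  rw [← mul_assoc A, trace_mul_comm]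
  simp only [mul_assoc]

theorem ofReal_re_conj_apply {H : Matrix ι ι ℂ} (hH : H.IsHermitian) (e : ι) (Z W : Matrix ι ι ℂ) :
    (((star Z * star W * H * W * Z) e e).re : ℂ) =
      (Z * single e e 1 * star Z * (star W * H * W)).trace := by
  have hM : (star Z * star W * H * W * Z).IsHermitian := by
    rw [show star Z * star W * H * W * Z = (W * Z)ᴴ * H * (W * Z) by
      simp only [conjTranspose_mul, star_eq_conjTranspose, mul_assoc]]
    exact isHermitian_conjTranspose_mul_mul _ hH
  rw [Complex.conj_eq_iff_re.1 (hM.apply e e), trace_mul_comm, trace_mul_conj_single]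
  simp only [mul_assoc]

/-- Expected product of two expectation values of a traceless observable `H`, in the states
`W * A * U * e` and `W * B * U * e` for Haar random `U` and `W`. -/
theorem integral_integral_re_mul_re [Nontrivial ι]
    [MeasurableSpace (unitaryGroup ι ℂ)] [BorelSpace (unitaryGroup ι ℂ)]
    (μ : Measure (unitaryGroup ι ℂ)) [μ.IsHaarMeasure] [IsProbabilityMeasure μ]
    {H : Matrix ι ι ℂ} (hH : H.IsHermitian) (hHtr : H.trace = 0)
    (hHtr2 : (H * H).trace = Fintype.card ι) (e : ι) {A B : Matrix ι ι ℂ}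
    (hA : A ∈ unitaryGroup ι ℂ) (hB : B ∈ unitaryGroup ι ℂ) :
    ((∫ U : unitaryGroup ι ℂ, ∫ W : unitaryGroup ι ℂ,
      ((star (U : Matrix ι ι ℂ) * star A * star (W : Matrix ι ι ℂ) * H * W * A * U) e e).re *
      ((star (U : Matrix ι ι ℂ) * star B * star (W : Matrix ι ι ℂ) * H * W * B * U) e e).re
        ∂μ ∂μ : ℝ) : ℂ) =
      ((star A * B).trace * (star B * A).trace - 1) /
        (((Fintype.card ι : ℂ) - 1) * (Fintype.card ι + 1) ^ 2) := by
  have := isInvInvariant_of_compactSpace μ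
  have hUU {U : Matrix ι ι ℂ} (hU : U ∈ unitaryGroup ι ℂ) : star U * U = 1 :=
    mem_unitaryGroup_iff'.1 hU
  set D : ℂ := (Fintype.card ι : ℂ) with hD
  have hcard : 1 < Fintype.card ι := Fintype.one_lt_card
  have hD0 : D ≠ 0 := by rw [hD]; exact_mod_cast (by lia : Fintype.card ι ≠ 0)
  have hD1 : D + 1 ≠ 0 := by rw [hD]; exact_mod_cast (by lia : Fintype.card ι + 1 ≠ 0)
  have hDm : D - 1 ≠ 0 := by rw [hD, sub_ne_zero]; exact_mod_cast hcard.ne'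
  let ρ (A : Matrix ι ι ℂ) (U : unitaryGroup ι ℂ) : Matrix ι ι ℂ :=
    A * (U : Matrix ι ι ℂ) * single e e 1 * star (A * (U : Matrix ι ι ℂ))
  have hρtr {A : Matrix ι ι ℂ} (hA : A ∈ unitaryGroup ι ℂ) (U : unitaryGroup ι ℂ) :
      (ρ A U).trace = 1 := by
    rw [trace_mul_comm, ← mul_assoc, hUU (mul_mem hA U.2), one_mul, trace_single_eq_same]
  have hentry (A : Matrix ι ι ℂ) (U W : unitaryGroup ι ℂ) :
      (((star (U : Matrix ι ι ℂ) * star A * star (W : Matrix ι ι ℂ) * H * W * A * U) e e).re : ℂ) =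
        (ρ A U * (star (W : Matrix ι ι ℂ) * H * W)).trace := by
    rw [← star_mul, mul_assoc _ A]
    exact ofReal_re_conj_apply hH e (A * (U : Matrix ι ι ℂ)) W
  have hinner (U : unitaryGroup ι ℂ) :
      ∫ W : unitaryGroup ι ℂ, (ρ A U * (star (W : Matrix ι ι ℂ) * H * W)).trace *
        (ρ B U * (star (W : Matrix ι ι ℂ) * H * W)).trace ∂μ =
      (D * (ρ A U * ρ B U).trace - 1) / ((D - 1) * (D + 1)) := by
    have := integral_trace_mul_conj_mul_trace_mul_conj μ H (ρ A U) (ρ B U)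
    rw [← hD, hHtr, hHtr2, hρtr hA, hρtr hB] at this
    rw [eq_div_iff (mul_ne_zero hDm hD1)]
    apply mul_left_cancel₀ hD0
    linear_combination this
  have houter : ∫ U : unitaryGroup ι ℂ, (ρ A U * ρ B U).trace ∂μ =
      ((star A * B).trace * (star B * A).trace + D) / (D * (D + 1)) := by
    have h := integral_trace_mul_conj_mul_trace_mul_conj μ (single e e 1) (star A * B) (star B * A)
    rw [← integral_inv_eq_self] at h
    simp only [UnitaryGroup.inv_val, star_star, ← trace_conj_single_mul_conj_single] at h
    change D * (D ^ 2 - 1) * ∫ U : unitaryGroup ι ℂ, (ρ A U * ρ B U).trace ∂μ = _ at h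
    have hAB : (star A * B * (star B * A)).trace = D := by
      rw [mul_assoc, ← mul_assoc B, mem_unitaryGroup_iff.1 hB, one_mul, hUU hA, trace_one]
    rw [← hD, hAB, single_mul_single_same, one_mul, trace_single_eq_same] at h
    rw [eq_div_iff (mul_ne_zero hD0 hD1)]
    apply mul_left_cancel₀ hDm
    linear_combination h
  have hρint : Integrable (fun U => (ρ A U * ρ B U).trace) μ := by
    refine Continuous.integrable_of_hasCompactSupport ?_ (.of_compactSpace _)
    simp only [ρ]
    fun_prop
  simp only [← integral_complex_ofReal, Complex.ofReal_mul, hentry, hinner]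
  rw [integral_div, integral_sub (hρint.const_mul D) (integrable_const _), integral_const_mul,
    houter]
  simp only [integral_const, probReal_univ, one_smul]
  field_simp
  ring

/-- **Expected ensemble kernel with Pauli-Z encoding.**
For `n ≥ 1` qubits, `d = 2ⁿ`, a traceless Hermitian observable `H` with `Tr H² = d`,
and the Pauli-Z encoding `S(x) = diag(exp(i x (2w(k) − n)))`, the expected tangent
kernel equals `d(s−1)/(d³+d²−d−1)` with
`s = C(2n,n) + 2 Σ_{m=1}^{n} C(2n,n−m) cos(2m(x−x′))`. -/
theorem ensemble_kernel_pauliZ (n : ℕ) (hn : 1 ≤ n)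
    [MeasurableSpace (Matrix.unitaryGroup (Fin (2 ^ n)) ℂ)]
    [BorelSpace (Matrix.unitaryGroup (Fin (2 ^ n)) ℂ)]
    (μ : Measure (Matrix.unitaryGroup (Fin (2 ^ n)) ℂ))
    [μ.IsHaarMeasure] [IsProbabilityMeasure μ]
    (H : Matrix (Fin (2 ^ n)) (Fin (2 ^ n)) ℂ) (hH : H.IsHermitian)
    (hHtr : H.trace = 0) (hHtr2 : (H * H).trace = ((2 ^ n : ℕ) : ℂ))
    (S : ℝ → Matrix (Fin (2 ^ n)) (Fin (2 ^ n)) ℂ)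
    (hS : ∀ x : ℝ, S x = Matrix.diagonal (fun k : Fin (2 ^ n) =>
        Complex.exp (Complex.I * (x : ℂ) *
          (2 * ((Nat.digits 2 (k : ℕ)).sum : ℂ) - (n : ℂ))))) :
    ∀ x x' : ℝ,
      ((2 ^ n : ℕ) : ℝ) *
        ∫ U : Matrix.unitaryGroup (Fin (2 ^ n)) ℂ,
          ∫ W : Matrix.unitaryGroup (Fin (2 ^ n)) ℂ,
            ((star (U : Matrix (Fin (2 ^ n)) (Fin (2 ^ n)) ℂ) * star (S x)
                * star (W : Matrix (Fin (2 ^ n)) (Fin (2 ^ n)) ℂ) * H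
                * (W : Matrix (Fin (2 ^ n)) (Fin (2 ^ n)) ℂ) * S x
                * (U : Matrix (Fin (2 ^ n)) (Fin (2 ^ n)) ℂ))
                ⟨0, by positivity⟩ ⟨0, by positivity⟩).re *
            ((star (U : Matrix (Fin (2 ^ n)) (Fin (2 ^ n)) ℂ) * star (S x')
                * star (W : Matrix (Fin (2 ^ n)) (Fin (2 ^ n)) ℂ) * H
                * (W : Matrix (Fin (2 ^ n)) (Fin (2 ^ n)) ℂ) * S x'
                * (U : Matrix (Fin (2 ^ n)) (Fin (2 ^ n)) ℂ))
                ⟨0, by positivity⟩ ⟨0, by positivity⟩).re ∂μ ∂μ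
      = ((2 ^ n : ℕ) : ℝ) *
          (((Nat.choose (2 * n) n : ℝ)
              + 2 * ∑ m ∈ Finset.Icc 1 n,
                  (Nat.choose (2 * n) (n - m) : ℝ) * Real.cos (2 * m * (x - x'))) - 1)
          / (((2 ^ n : ℕ) : ℝ) ^ 3 + ((2 ^ n : ℕ) : ℝ) ^ 2 - ((2 ^ n : ℕ) : ℝ) - 1) := by
  intro x x'
  have : Nontrivial (Fin (2 ^ n)) := Fin.nontrivial_iff_two_le.2 (Nat.le_self_pow (by lia) 2)
  have hstar (x : ℝ) : star (S x) = S (-x) := by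
    rw [hS, hS, star_eq_conjTranspose, diagonal_conjTranspose]
    congr 1
    ext k
    simp only [Pi.star_apply]
    generalize (Nat.digits 2 (k : ℕ)).sum = w
    simp [← Complex.exp_conj, Complex.conj_ofNat]
  have hmul (x y : ℝ) : S x * S y = S (x + y) := by
    rw [hS, hS, hS, diagonal_mul_diagonal]
    congr 1
    ext k
    rw [← Complex.exp_add]
    push_cast
    ring_nf
  have hmem (x : ℝ) : S x ∈ unitaryGroup (Fin (2 ^ n)) ℂ := by
    rw [mem_unitaryGroup_iff, hstar, hmul, add_neg_cancel, hS]
    simp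
  have htrace (x : ℝ) : (S x).trace = (2 * Complex.cos x) ^ n := by
    rw [hS, trace_diagonal, sum_exp_digits]
  have h := integral_integral_re_mul_re μ hH hHtr (by rw [hHtr2, Fintype.card_fin])
    ⟨0, by positivity⟩ (hmem x) (hmem x')
  have hcos : (star (S x) * S x').trace * (star (S x') * S x).trace =
      (((2 * Real.cos (x - x')) ^ (2 * n) : ℝ) : ℂ) := by
    rw [hstar, hstar, hmul, hmul, htrace, htrace, show -x + x' = -(x - x') by ring,
      show -x' + x = x - x' by ring]
    push_cast
    rw [Complex.cos_neg]
    ring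
  rw [hcos, Fintype.card_fin] at h
  rw [← two_mul_cos_pow_two_mul, mul_div_assoc]
  congr 1
  rw [← Complex.ofReal_inj, h]
  push_cast
  ring
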